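/- arXiv:1708.06174 — 2 statements merged into one kernel-verified Lean document; each statement's English description precedes it below -/
import Mathlib

section
/- Let Γ be a subgroup of SL(2,ℝ) and let r > 0. Assume that for every γ ∈ Γ with γ ≠ 1 and every z in the upper half-plane ℍ one has d_ℍ(z, γ·z) ≥ r. Then for every z ∈ ℍ the family (exp(−2·d_ℍ(z, γ·z)))_{γ ∈ Γ} is summable and ∑_{γ ∈ Γ} exp(−2·d_ℍ(z, γ·z)) ≤ 9 + 1/(4·sinh²(r/4)). -/
open Real UpperHalfPlane Matrix
open scoped MatrixGroups
open MeasureTheory Set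

theorem hasDerivAt_sqrt_sub_sq_div_sq_primitive {C S Y y : ℝ} (hS : 0 < S) (hY : 0 < Y)
    (hCSY : C ^ 2 = S ^ 2 + Y ^ 2) (hy : 0 < y) (hQ : 0 < S ^ 2 - (y - C) ^ 2) :
    HasDerivAt (fun y ↦ -√(S ^ 2 - (y - C) ^ 2) / y - arcsin ((y - C) / S)
      + C / Y * arcsin (C / S - Y ^ 2 / S / y)) (√(S ^ 2 - (y - C) ^ 2) / y ^ 2) y := by
  have hq := Real.sqrt_pos.2 hQ
  have hqq := Real.sq_sqrt hQ.le
  set q := √(S ^ 2 - (y - C) ^ 2) with hqdef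
  have e1 : √(1 - ((y - C) / S) ^ 2) = q / S := by
    rw [Real.sqrt_eq_iff_mul_self_eq_of_pos (by positivity)]
    field_simp
    linear_combination hqq
  have e2 : √(1 - (C / S - Y ^ 2 / S / y) ^ 2) = Y * q / (S * y) := by
    rw [Real.sqrt_eq_iff_mul_self_eq_of_pos (by positivity)]
    field_simp
    linear_combination Y ^ 2 * hqq + (y ^ 2 - Y ^ 2) * hCSY
  have b1 : ((y - C) / S) ^ 2 < 1 := by
    rw [← sub_pos, ← Real.sqrt_pos, e1]; positivity
  have b2 : (C / S - Y ^ 2 / S / y) ^ 2 < 1 := by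
    rw [← sub_pos, ← Real.sqrt_pos, e2]; positivity
  have c1 := abs_lt.1 ((sq_lt_one_iff_abs_lt_one _).1 b1)
  have c2 := abs_lt.1 ((sq_lt_one_iff_abs_lt_one _).1 b2)
  have d0 : HasDerivAt (fun y : ℝ ↦ S ^ 2 - (y - C) ^ 2) (-(2 * (y - C))) y := by
    simpa using (((hasDerivAt_id y).sub_const C).pow 2).const_sub (S ^ 2)
  have d1 : HasDerivAt (fun y ↦ -√(S ^ 2 - (y - C) ^ 2) / y)
      ((-(-(2 * (y - C)) / (2 * q)) * y - -q * 1) / y ^ 2) y :=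
    (d0.sqrt hQ.ne').fun_neg.fun_div (hasDerivAt_id' y) hy.ne'
  have d2 := (hasDerivAt_arcsin c1.1.ne' c1.2.ne).comp y
    (((hasDerivAt_id y).sub_const C).div_const S)
  have d3 := (hasDerivAt_arcsin c2.1.ne' c2.2.ne).comp y
    (((hasDerivAt_inv hy.ne').const_mul (Y ^ 2 / S)).const_sub (C / S))
  refine ((d1.sub d2).add (d3.const_mul (C / Y))).congr_deriv ?_
  rw [e1, e2]
  field_simp
  ring

theorem lintegral_sqrt_sub_sq_div_sq {C S Y : ℝ} (hC : 0 < C) (hS : 0 < S) (hY : 0 < Y)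
    (hCSY : C ^ 2 = S ^ 2 + Y ^ 2) :
    ∫⁻ y, ENNReal.ofReal (2 * (√(S ^ 2 - (y - C) ^ 2) / y ^ 2)) =
      ENNReal.ofReal (2 * π * (C / Y - 1)) := by
  have hSC : S < C := lt_of_pow_lt_pow_left₀ 2 hC.le (by nlinarith [sq_pos_of_pos hY])
  have hsub : C - S ≤ C + S := by linarith
  have hpos : ∀ y ∈ Icc (C - S) (C + S), 0 < y := fun y hy ↦ by linarith [hy.1]
  have hcont : ContinuousOn (fun y ↦ -√(S ^ 2 - (y - C) ^ 2) / y - arcsin ((y - C) / S)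
      + C / Y * arcsin (C / S - Y ^ 2 / S / y)) (Icc (C - S) (C + S)) := by
    have h0 : ∀ y ∈ Icc (C - S) (C + S), y ≠ 0 := fun y hy ↦ (hpos y hy).ne'
    refine ((ContinuousOn.div (by fun_prop) (by fun_prop) h0).sub ?_).add
      (continuousOn_const.mul (continuous_arcsin.comp_continuousOn
        (continuousOn_const.sub (continuousOn_const.div continuousOn_id h0))))
    exact (continuous_arcsin.comp (by fun_prop)).continuousOn
  have hderiv := fun y (hy : y ∈ Ioo (C - S) (C + S)) ↦
    hasDerivAt_sqrt_sub_sq_div_sq_primitive hS hY hCSY (hpos y (Ioo_subset_Icc_self hy))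
      (by nlinarith [mul_pos (sub_pos.2 hy.1) (sub_pos.2 hy.2)])
  have hint := intervalIntegral.integrableOn_deriv_of_nonneg hcont hderiv
    (fun y _ ↦ by positivity)
  have hFTC := intervalIntegral.integral_eq_sub_of_hasDerivAt_of_le hsub hcont hderiv
    ((intervalIntegrable_iff_integrableOn_Ioc_of_le hsub).2 hint)
  rw [intervalIntegral.integral_of_le hsub] at hFTC
  have hval : ∫ y in Ioc (C - S) (C + S), √(S ^ 2 - (y - C) ^ 2) / y ^ 2 = π * (C / Y - 1) := by
    rw [hFTC]
    have t1 : C / S - Y ^ 2 / S / (C + S) = 1 := by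
      have : C + S ≠ 0 := by positivity
      field_simp
      linear_combination hCSY
    have t2 : C / S - Y ^ 2 / S / (C - S) = -1 := by
      have : C - S ≠ 0 := (sub_pos.2 hSC).ne'
      field_simp
      linear_combination hCSY
    rw [t1, t2]
    have t3 : (C + S - C) / S = 1 := by field_simp; ring
    have t4 : (C - S - C) / S = -1 := by field_simp; ring
    rw [t3, t4, arcsin_neg, arcsin_one]
    simp only [add_sub_cancel_left, sub_sub_cancel_left, neg_sq, sub_self, Real.sqrt_zero]
    ring
  have hsupp : (fun y ↦ ENNReal.ofReal (2 * (√(S ^ 2 - (y - C) ^ 2) / y ^ 2))) =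
      (Ioc (C - S) (C + S)).indicator
        fun y ↦ ENNReal.ofReal (2 * (√(S ^ 2 - (y - C) ^ 2) / y ^ 2)) := by
    refine (indicator_eq_self.2 fun y hy ↦ ?_).symm
    by_contra hy'
    refine hy ?_
    have : S ^ 2 - (y - C) ^ 2 ≤ 0 := by
      rw [mem_Ioc, not_and_or, not_lt, not_le] at hy'
      rcases hy' with h | h <;> nlinarith
    simp [Real.sqrt_eq_zero_of_nonpos this]
  rw [hsupp, lintegral_indicator measurableSet_Ioc,
    ← ofReal_integral_eq_lintegral_ofReal (hint.const_mul 2) (ae_of_all _ fun y ↦ by positivity),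
    integral_const_mul, hval, mul_assoc]

/-- The hyperbolic area of a disc of radius `ρ` is `2π (cosh ρ - 1)`. -/
theorem UpperHalfPlane.volume_ball (z : ℍ) {ρ : ℝ} (hρ : 0 < ρ) :
    volume (Metric.ball z ρ) = ENNReal.ofReal (2 * π * (cosh ρ - 1)) := by
  have hS : 0 < z.im * sinh ρ := mul_pos z.im_pos (sinh_pos_iff.2 hρ)
  have key := lintegral_sqrt_sub_sq_div_sq (C := z.im * cosh ρ)
    (mul_pos z.im_pos (cosh_pos ρ)) hS z.im_pos
    (by rw [mul_pow, cosh_sq]; ring)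
  rw [mul_div_cancel_left₀ _ z.im_ne_zero] at key
  rw [volume_eq_lintegral, image_coe_ball, ← key, ← lintegral_indicator measurableSet_ball,
    ← Complex.volume_preserving_equiv_real_prod.symm.lintegral_comp_emb
      Complex.measurableEquivRealProd.symm.measurableEmbedding, Measure.volume_eq_prod,
    lintegral_prod_symm]
  · refine lintegral_congr fun y ↦ ?_
    set q := √((z.im * sinh ρ) ^ 2 - (y - z.im * cosh ρ) ^ 2) with hq
    have : (fun x : ℝ ↦ (Metric.ball (z.center ρ : ℂ) (z.im * sinh ρ)).indicator
        (fun w : ℂ ↦ (((1 / ‖w.im‖₊) ^ 2 : NNReal) : ENNReal))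
        (Complex.measurableEquivRealProd.symm (x, y))) =
        (Ioo (z.re - q) (z.re + q)).indicator fun _ ↦ ENNReal.ofReal (1 / y ^ 2) := by
      ext x
      have hmem : Complex.measurableEquivRealProd.symm (x, y) ∈
          Metric.ball (z.center ρ : ℂ) (z.im * sinh ρ) ↔ x ∈ Ioo (z.re - q) (z.re + q) := by
        rw [Metric.mem_ball, Complex.dist_eq_re_im, Real.sqrt_lt' hS, ← lt_sub_iff_add_lt,
          ← sq_abs, ← Real.lt_sqrt (abs_nonneg _), abs_lt]
        simp only [Complex.measurableEquivRealProd_symm_apply, coe_re, coe_im, center_re,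
          center_im, ← hq, mem_Ioo]
        constructor <;> rintro ⟨h, h'⟩ <;> constructor <;> linarith
      by_cases hx : x ∈ Ioo (z.re - q) (z.re + q)
      · rw [indicator_of_mem hx, indicator_of_mem (hmem.2 hx), ← ENNReal.ofReal_coe_nnreal]
        simp
      · rw [indicator_of_notMem hx, indicator_of_notMem (mt hmem.1 hx)]
    rw [this, lintegral_indicator measurableSet_Ioo, setLIntegral_const, Real.volume_Ioo,
      ← ENNReal.ofReal_mul (by positivity)]
    congr 1
    ring
  · refine Measurable.aemeasurable ?_
    refine (Measurable.indicator ?_ measurableSet_ball).comp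
      Complex.measurableEquivRealProd.symm.measurable
    fun_prop

/-- Packing bound: if `Γ` displaces every point by at least `r`, then at most
`(cosh (R + r / 2) - 1) / (cosh (r / 2) - 1)` elements of `Γ` move `z` by at most `R`. -/
theorem card_le_of_le_displacement {Γ : Subgroup SL(2, ℝ)} {r : ℝ} (hr : 0 < r)
    (hdisp : ∀ γ ∈ Γ, γ ≠ 1 → ∀ z : ℍ, r ≤ dist z (γ • z)) (z : ℍ) (F : Finset Γ) {R : ℝ}
    (hR : 0 ≤ R) (hF : ∀ γ ∈ F, dist z ((γ : SL(2, ℝ)) • z) ≤ R) :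
    (F.card : ℝ) ≤ (cosh (R + r / 2) - 1) / (cosh (r / 2) - 1) := by
  have hdisj : (F : Set Γ).PairwiseDisjoint
      fun γ ↦ Metric.ball ((γ : SL(2, ℝ)) • z) (r / 2) := by
    intro γ _ γ' _ hne
    refine Metric.ball_disjoint_ball ?_
    rw [add_halves, ← dist_smul (γ : SL(2, ℝ))⁻¹, inv_smul_smul, smul_smul]
    refine hdisp _ (Γ.mul_mem (Γ.inv_mem γ.2) γ'.2) (fun h ↦ hne ?_) z
    exact Subtype.ext (inv_mul_eq_one.1 h)
  have hsub : (⋃ γ ∈ F, Metric.ball ((γ : SL(2, ℝ)) • z) (r / 2)) ⊆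
      Metric.ball z (R + r / 2) :=
    iUnion₂_subset fun γ hγ ↦ Metric.ball_subset_ball' (by
      rw [dist_comm]; linarith [hF γ hγ])
  have hcosh : 0 < cosh (r / 2) - 1 := sub_pos.2 (one_lt_cosh.2 (by positivity))
  have hle := measure_mono (μ := volume) hsub
  rw [measure_biUnion_finset hdisj fun _ _ ↦ measurableSet_ball] at hle
  simp only [volume_ball _ (half_pos hr), volume_ball z (by positivity : 0 < R + r / 2),
    Finset.sum_const, nsmul_eq_mul] at hle
  rw [← ENNReal.ofReal_natCast, ← ENNReal.ofReal_mul (by positivity),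
    ENNReal.ofReal_le_ofReal_iff (mul_nonneg (by positivity) (sub_nonneg.2 (one_le_cosh _)))] at hle
  rw [le_div_iff₀ hcosh]
  refine le_of_mul_le_mul_left (a := 2 * π) ?_ (by positivity)
  linarith

theorem sum_exp_neg_two_mul_le_integral {ι : Type*} (F : Finset ι) (d : ι → ℝ) {r : ℝ}
    (hd : ∀ i ∈ F, r ≤ d i) {N : ℝ → ℝ}
    (hN : ∀ R > r, (({i ∈ F | d i < R} : Finset ι).card : ℝ) ≤ N R)
    (hint : IntegrableOn (fun R ↦ 2 * exp (-2 * R) * N R) (Ioi r)) :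
    ∑ i ∈ F, exp (-2 * d i) ≤ ∫ R in Ioi r, 2 * exp (-2 * R) * N R := by
  have hexp : IntegrableOn (fun R ↦ 2 * exp (-2 * R)) (Ioi r) :=
    (integrableOn_exp_mul_Ioi (by norm_num) r).const_mul 2
  have hterm : ∀ i ∈ F, exp (-2 * d i) =
      ∫ R in Ioi r, (Ioi (d i)).indicator (fun R ↦ 2 * exp (-2 * R)) R := by
    intro i hi
    rw [setIntegral_indicator measurableSet_Ioi, Ioi_inter_Ioi, sup_eq_right.2 (hd i hi),
      integral_const_mul, integral_exp_mul_Ioi (by norm_num)]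
    ring
  rw [Finset.sum_congr rfl hterm,
    ← integral_finsetSum _ fun i _ ↦ hexp.indicator measurableSet_Ioi]
  refine setIntegral_mono_on
    (integrable_finsetSum _ fun i _ ↦ hexp.indicator measurableSet_Ioi) hint
    measurableSet_Ioi fun R hR ↦ ?_
  simp only [indicator_apply, mem_Ioi]
  rw [← Finset.sum_filter, Finset.sum_const, nsmul_eq_mul, mul_comm]
  exact mul_le_mul_of_nonneg_left (hN R hR) (by positivity)

theorem integral_exp_mul_cosh_sub_one {u : ℝ} :
    IntegrableOn (fun R ↦ 2 * exp (-2 * R) * ((cosh (R + u) - 1) / (cosh u - 1))) (Ioi (2 * u)) ∧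
    ∫ R in Ioi (2 * u), 2 * exp (-2 * R) * ((cosh (R + u) - 1) / (cosh u - 1)) =
      (exp (-u) + exp (-u) ^ 7 / 3 - exp (-u) ^ 4) / (cosh u - 1) := by
  have heq : (fun R ↦ 2 * exp (-2 * R) * ((cosh (R + u) - 1) / (cosh u - 1))) =
      fun R ↦ (exp u * exp (-1 * R) + exp (-u) * exp (-3 * R) - 2 * exp (-2 * R)) /
        (cosh u - 1) := by
    ext R
    rw [cosh_eq (R + u), mul_div_assoc']
    congr 1
    have h1 : exp (-2 * R) * exp (R + u) = exp u * exp (-1 * R) := by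
      rw [← exp_add, ← exp_add]; ring_nf
    have h2 : exp (-2 * R) * exp (-(R + u)) = exp (-u) * exp (-3 * R) := by
      rw [← exp_add, ← exp_add]; ring_nf
    linear_combination h1 + h2
  have i1 := (integrableOn_exp_mul_Ioi (a := -1) (by norm_num) (2 * u)).const_mul (exp u)
  have i2 := (integrableOn_exp_mul_Ioi (a := -2) (by norm_num) (2 * u)).const_mul 2
  have i3 := (integrableOn_exp_mul_Ioi (a := -3) (by norm_num) (2 * u)).const_mul (exp (-u))
  rw [heq]
  refine ⟨((i1.add i3).sub i2).div_const _, ?_⟩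
  rw [integral_div,
    integral_sub (f := fun R ↦ exp u * exp (-1 * R) + exp (-u) * exp (-3 * R)) (i1.add i3) i2,
    integral_add i1 i3]
  simp only [integral_const_mul]
  rw [integral_exp_mul_Ioi (by norm_num), integral_exp_mul_Ioi (by norm_num),
    integral_exp_mul_Ioi (by norm_num), ← exp_nat_mul, ← exp_nat_mul]
  congr 1
  have h1 : exp u * exp (-1 * (2 * u)) = exp (-u) := by rw [← exp_add]; ring_nf
  have h2 : exp (-u) * exp (-3 * (2 * u)) = exp (((7 : ℕ) : ℝ) * -u) := by
    rw [← exp_add]; push_cast; ring_nf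
  have h3 : exp (-2 * (2 * u)) = exp (((4 : ℕ) : ℝ) * -u) := by push_cast; ring_nf
  linear_combination h1 + h2 / 3 - h3

theorem one_add_div_cosh_sub_one_le {u : ℝ} (hu : 0 < u) :
    1 + (exp (-u) + exp (-u) ^ 7 / 3 - exp (-u) ^ 4) / (cosh u - 1) ≤
      9 + 1 / (2 * (cosh u - 1)) := by
  have hx0 := exp_pos (-u)
  have hx1 : exp (-u) < 1 := by simpa using hu
  have hc : cosh u - 1 = (1 - exp (-u)) ^ 2 / (2 * exp (-u)) := by
    rw [cosh_eq, Real.exp_neg]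
    have := exp_pos u
    field_simp
    ring
  rw [hc]
  generalize exp (-u) = x at *
  have h1 : 0 < 1 - x := by linarith
  have h8 : x ^ 8 ≤ x ^ 5 := pow_le_pow_of_le_one hx0.le hx1.le (by norm_num)
  have hpoly : x ^ 2 + x ^ 8 / 3 - x ^ 5 - x / 2 ≤ 4 * (1 - x) ^ 2 := by
    nlinarith [mul_nonneg hx0.le (sq_nonneg (x ^ 2 - 0.8)), sq_nonneg (x - 0.87),
      mul_nonneg hx0.le (sq_nonneg (x - 0.9))]
  rw [← sub_nonneg]
  have : 9 + 1 / (2 * ((1 - x) ^ 2 / (2 * x))) -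
      (1 + (x + x ^ 7 / 3 - x ^ 4) / ((1 - x) ^ 2 / (2 * x))) =
      2 * (4 * (1 - x) ^ 2 - (x ^ 2 + x ^ 8 / 3 - x ^ 5 - x / 2)) / (1 - x) ^ 2 := by
    field_simp
    ring
  rw [this]
  exact div_nonneg (by linarith) (by positivity)

/-- If every nontrivial element of a subgroup `Γ ≤ SL(2, ℝ)` displaces every point of the
hyperbolic upper half-plane by at least `r > 0`, then for every `z ∈ ℍ` the family
`γ ↦ exp(−2·d(z, γz))` is summable over `Γ` with sum at most `9 + 1/(4·sinh²(r/4))`. -/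
theorem sum_exp_neg_two_dist_le (Γ : Subgroup SL(2, ℝ)) (r : ℝ) (hr : 0 < r)
    (hdisp : ∀ γ ∈ Γ, γ ≠ 1 → ∀ z : ℍ, r ≤ dist z (γ • z)) (z : ℍ) :
    Summable (fun γ : Γ => Real.exp (-2 * dist z ((γ : SL(2, ℝ)) • z))) ∧
      ∑' γ : Γ, Real.exp (-2 * dist z ((γ : SL(2, ℝ)) • z)) ≤
        9 + 1 / (4 * Real.sinh (r / 4) ^ 2) := by
  classical
  have hsinh : 4 * sinh (r / 4) ^ 2 = 2 * (cosh (r / 2) - 1) := by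
    rw [show r / 2 = 2 * (r / 4) by ring, cosh_two_mul, cosh_sq]
    ring
  have hbound (F : Finset Γ) : ∑ γ ∈ F, exp (-2 * dist z ((γ : SL(2, ℝ)) • z)) ≤
      9 + 1 / (4 * sinh (r / 4) ^ 2) := by
    obtain ⟨hint, hval⟩ := integral_exp_mul_cosh_sub_one (u := r / 2)
    rw [mul_div_cancel₀ r two_ne_zero] at hint hval
    have hsum := sum_exp_neg_two_mul_le_integral (F.erase 1)
      (fun γ ↦ dist z ((γ : SL(2, ℝ)) • z))
      (fun γ hγ ↦ hdisp γ γ.2 (by simpa using Finset.ne_of_mem_erase hγ) z)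
      (fun R hR ↦ card_le_of_le_displacement hr hdisp z _ (hr.trans hR).le
        fun γ hγ ↦ (Finset.mem_filter.1 hγ).2.le) hint
    rw [hval] at hsum
    calc _ ≤ ∑ γ ∈ insert 1 (F.erase 1), exp (-2 * dist z ((γ : SL(2, ℝ)) • z)) :=
          Finset.sum_le_sum_of_subset_of_nonneg (fun γ hγ ↦ by by_cases h : γ = 1 <;> simp [h, hγ])
            fun _ _ _ ↦ (exp_pos _).le
      _ ≤ _ := by
        rw [Finset.sum_insert (Finset.notMem_erase 1 F), hsinh]
        refine le_trans ?_ (one_add_div_cosh_sub_one_le (half_pos hr))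
        simpa using hsum
  have hsummable := summable_of_sum_le (fun _ ↦ (exp_pos _).le) hbound
  exact ⟨hsummable, hsummable.tsum_le_of_sum_le hbound⟩
end

section
/- Let F be a totally real number field of degree d with real embeddings σ₁,…,σ_d : F → ℝ and unit group O_F^× of its ring of integers. Let k₁,…,k_d be positive integers and y₁,…,y_d > 0 real numbers. Then ∑_{ε ∈ O_F^×} ∏_{j=1}^{d} |σ_j(ε)|^{2k_j−1} · y_j · ((1 + σ_j(ε)²)/2)^{1−2k_j} ≤ ∏_{j=1}^{d} 2π·y_j. -/
open NumberField Real

theorem one_add_sq_le_exp_abs (x : ℝ) : 1 + x ^ 2 ≤ exp |x| := by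
  have h := quadratic_le_exp_of_nonneg (x := |x| / 2) (by positivity)
  have hx := abs_nonneg x
  calc 1 + x ^ 2 = 1 + |x| ^ 2 := by rw [sq_abs]
    _ ≤ (1 + |x| / 2 + (|x| / 2) ^ 2 / 2) ^ 2 := by
        nlinarith [mul_nonneg hx (sq_nonneg (|x| - 2)), sq_nonneg (|x| ^ 2)]
    _ ≤ exp (|x| / 2) ^ 2 := by gcongr
    _ = exp |x| := by rw [← exp_nat_mul]; congr 1; push_cast; ring

theorem exp_half_mul_factorial_le_pow_self (d : ℕ) (hd : 3 ≤ d) :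
    exp ((d : ℝ) / 2) * d.factorial ≤ (d : ℝ) ^ d := by
  have he := exp_one_lt_d9
  induction d, hd using Nat.le_induction with
  | base =>
    have h : exp (3 / 2 : ℝ) ≤ 4.5 := by
      refine le_of_sq_le_sq ?_ (by norm_num)
      calc exp (3 / 2 : ℝ) ^ 2 = exp 1 ^ 3 := by
            rw [← exp_nat_mul, ← exp_nat_mul]; norm_num
        _ ≤ 2.7182818286 ^ 3 := by gcongr
        _ ≤ 4.5 ^ 2 := by norm_num
    norm_num [Nat.factorial]
    linarith
  | succ n hn ih =>
    have hn0 : (0 : ℝ) < n := by exact_mod_cast (by omega : 0 < n)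
    have h1 : exp (1 / 2 : ℝ) ≤ 2 := by
      refine le_of_sq_le_sq ?_ (by norm_num)
      rw [← exp_nat_mul]
      norm_num
      linarith
    have h2 : 2 * (n : ℝ) ^ n ≤ ((n : ℝ) + 1) ^ n := by
      have h := one_add_mul_le_pow (a := 1 / (n : ℝ)) (by have : 0 < 1 / (n : ℝ) := by positivity
                                                          linarith) n
      have h' : (1 + (n : ℝ) * (1 / n)) = 2 := by field_simp; norm_num
      rw [h'] at h
      calc 2 * (n : ℝ) ^ n ≤ (1 + 1 / (n : ℝ)) ^ n * (n : ℝ) ^ n := by gcongr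
        _ = ((n : ℝ) + 1) ^ n := by rw [← mul_pow]; congr 1; field_simp
    calc exp (((n + 1 : ℕ) : ℝ) / 2) * (n + 1).factorial
        = exp (1 / 2) * (exp ((n : ℝ) / 2) * n.factorial) * (n + 1) := by
          rw [Nat.factorial_succ, Nat.cast_succ, add_div, exp_add]; push_cast; ring
      _ ≤ 2 * (n : ℝ) ^ n * (n + 1) := by gcongr
      _ ≤ ((n : ℝ) + 1) ^ n * (n + 1) := by gcongr
      _ = ((n + 1 : ℕ) : ℝ) ^ (n + 1) := by push_cast; ring

theorem prod_one_add_sq_mul_factorial_le {d : ℕ} (hd : 2 ≤ d) (b : Fin d → ℝ)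
    (hb : ∑ j, |b j| < (d : ℝ) / 2) :
    (∏ j, (1 + b j ^ 2)) * d.factorial ≤ (d : ℝ) ^ d := by
  obtain rfl | hd := hd.eq_or_lt
  · rw [Fin.sum_univ_two] at hb
    rw [Fin.prod_univ_two]
    norm_num [Nat.factorial] at hb ⊢
    have h0 := abs_nonneg (b 0)
    have h1 := abs_nonneg (b 1)
    have hmul : |b 0| * |b 1| ≤ 1 := mul_le_one₀ (by linarith) h1 (by linarith)
    have hsq : (|b 0| + |b 1|) ^ 2 ≤ 1 := pow_le_one₀ (by positivity) hb.le
    rw [← sq_abs (b 0), ← sq_abs (b 1)]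
    nlinarith [mul_nonneg (mul_nonneg h0 h1) (sub_nonneg.mpr hmul), mul_nonneg h0 h1]
  · refine le_trans ?_ (exp_half_mul_factorial_le_pow_self d hd)
    gcongr
    calc ∏ j, (1 + b j ^ 2) ≤ ∏ j, exp |b j| :=
          Finset.prod_le_prod (fun _ _ => by positivity) fun j _ => one_add_sq_le_exp_abs (b j)
      _ = exp (∑ j, |b j|) := (exp_sum _ _).symm
      _ ≤ exp ((d : ℝ) / 2) := by gcongr

theorem two_mul_prod_le_prod_add_prod {ι : Type*} [Fintype ι] (x b : ι → ℝ) :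
    2 * ((∏ j, (1 + x j ^ 2)⁻¹) * ∏ j, (1 + b j ^ 2)⁻¹) ≤
      ∏ j, (1 + (x j + b j) ^ 2)⁻¹ + ∏ j, (1 + (x j - b j) ^ 2)⁻¹ := by
  have h : ((∏ j, (1 + x j ^ 2)⁻¹) * ∏ j, (1 + b j ^ 2)⁻¹) ^ 2 ≤
      (∏ j, (1 + (x j + b j) ^ 2)⁻¹) * ∏ j, (1 + (x j - b j) ^ 2)⁻¹ := by
    simp only [← Finset.prod_mul_distrib, ← Finset.prod_pow, ← mul_inv]
    refine Finset.prod_le_prod (fun _ _ => by positivity) fun j _ => ?_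
    rw [inv_pow]
    refine inv_anti₀ (by positivity) ?_
    have : 0 ≤ 4 * (x j * b j) ^ 2 + 2 * x j ^ 4 * b j ^ 2 + 2 * (x j * b j ^ 2) ^ 2
      + (x j ^ 2 * b j ^ 2) ^ 2 := by positivity
    nlinarith [sq_nonneg (x j * b j)]
  refine le_of_sq_le_sq ?_ (by positivity)
  nlinarith [sq_nonneg (∏ j, (1 + (x j + b j) ^ 2)⁻¹ - ∏ j, (1 + (x j - b j) ^ 2)⁻¹)]

open MeasureTheory

theorem integrable_prod_inv_one_add_sq (ι : Type*) [Fintype ι] :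
    Integrable fun x : ι → ℝ => ∏ j, (1 + x j ^ 2)⁻¹ :=
  Integrable.fintype_prod (f := fun _ (t : ℝ) => (1 + t ^ 2)⁻¹) fun _ => integrable_inv_one_add_sq

theorem integral_prod_inv_one_add_sq (ι : Type*) [Fintype ι] :
    ∫ x : ι → ℝ, ∏ j, (1 + x j ^ 2)⁻¹ = π ^ Fintype.card ι := by
  rw [integral_fintype_prod_volume_eq_prod (fun _ (t : ℝ) => (1 + t ^ 2)⁻¹)]
  simp [integral_univ_inv_one_add_sq]

theorem measurableSet_sum_abs_sub_lt {ι : Type*} [Fintype ι] (a : ι → ℝ) (r : ℝ) :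
    MeasurableSet {x : ι → ℝ | ∑ j, |x j - a j| < r} :=
  (isOpen_lt (by fun_prop) continuous_const).measurableSet

theorem volume_real_sum_abs_lt {d : ℕ} (hd : 0 < d) {r : ℝ} (hr : 0 ≤ r) :
    volume.real {x : Fin d → ℝ | ∑ j, |x j| < r} = (2 * r) ^ d / d.factorial := by
  have : Nonempty (Fin d) := ⟨⟨0, hd⟩⟩
  have h := volume_sum_rpow_lt (Fin d) le_rfl r
  norm_num [Gamma_nat_eq_factorial] at h
  rw [measureReal_def, h, ENNReal.toReal_mul, ENNReal.toReal_pow, ENNReal.toReal_ofReal hr,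
    ENNReal.toReal_ofReal (by positivity), mul_pow]
  ring

/-- The integral of `∏ j, (1 + x j ^ 2)⁻¹` over the open `ℓ¹`-ball of radius `d / 2` centred at `a`
is at least the value of the integrand at `a`. -/
theorem prod_inv_one_add_sq_le_setIntegral {d : ℕ} (hd : 2 ≤ d) (a : Fin d → ℝ) :
    ∏ j, (1 + a j ^ 2)⁻¹ ≤
      ∫ x in {x : Fin d → ℝ | ∑ j, |x j - a j| < (d : ℝ) / 2}, ∏ j, (1 + x j ^ 2)⁻¹ := by
  set G : (Fin d → ℝ) → ℝ := fun x => ∏ j, (1 + x j ^ 2)⁻¹ with hG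
  set B : Set (Fin d → ℝ) := {x | ∑ j, |x j| < (d : ℝ) / 2} with hB
  set S : Set (Fin d → ℝ) := {x | ∑ j, |x j - a j| < (d : ℝ) / 2} with hS
  have hd0 : (0 : ℝ) < d := by exact_mod_cast (by omega : 0 < d)
  have hint : Integrable G := integrable_prod_inv_one_add_sq (Fin d)
  have hBm : MeasurableSet B := 
    (isOpen_lt (by fun_prop) continuous_const).measurableSet
  have hvol : volume.real B = (d : ℝ) ^ d / d.factorial := by
    rw [hB, volume_real_sum_abs_lt (by omega) (by positivity)]
    congr 2; ring
  have hvol0 : volume.real B ≠ 0 := by rw [hvol]; positivity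
  have hadd : ∫ b in B, G (a + b) = ∫ x in S, G x := by
    rw [← (measurePreserving_add_left volume a).setIntegral_preimage_emb
      (measurableEmbedding_addLeft a) G S]
    congr 2; ext b; simp [hB, hS]
  have hsub : ∫ b in B, G (a - b) = ∫ x in S, G x := by
    rw [← (Measure.measurePreserving_sub_left volume a).setIntegral_preimage_emb
      (measurableEmbedding_subLeft a) G S]
    congr 2; ext b; simp [hB, hS]
  have hia : IntegrableOn (fun b => G (a + b)) B := (hint.comp_add_left a).integrableOn
  have his : IntegrableOn (fun b => G (a - b)) B := (hint.comp_sub_left a).integrableOn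
  have hmono : ∫ _ in B, 2 * (G a * (volume.real B)⁻¹) ≤ ∫ b in B, (G (a + b) + G (a - b)) := by
    refine setIntegral_mono_on ?_ (hia.add his) hBm fun b hb => ?_
    · refine integrableOn_const fun htop => hvol0 ?_
      rw [measureReal_def, htop, ENNReal.toReal_top]
    · refine le_trans ?_ (two_mul_prod_le_prod_add_prod a b)
      have hc := prod_one_add_sq_mul_factorial_le hd b hb
      have hinv : (volume.real B)⁻¹ ≤ ∏ j, (1 + b j ^ 2)⁻¹ := by
        rw [Finset.prod_inv_distrib]
        refine inv_anti₀ (Finset.prod_pos fun _ _ => by positivity) ?_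
        rwa [hvol, le_div_iff₀ (by positivity)]
      have hG0 : 0 ≤ G a := Finset.prod_nonneg fun _ _ => by positivity
      exact mul_le_mul_of_nonneg_left (mul_le_mul_of_nonneg_left hinv hG0) zero_le_two
  rw [setIntegral_const, integral_add hia his, hadd, hsub, smul_eq_mul] at hmono
  have : volume.real B * (2 * (G a * (volume.real B)⁻¹)) = 2 * G a := by field_simp
  change G a ≤ _
  linarith

/-- A packing bound: if the points `a i` are at mutual `ℓ¹`-distance at least `d`, then the sum of
`∏ j, (1 + x j ^ 2)⁻¹` over them is at most its integral over `ℝᵈ`. -/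
theorem sum_prod_inv_one_add_sq_le {α : Type*} {d : ℕ} (hd : 2 ≤ d) (s : Finset α)
    (a : α → Fin d → ℝ)
    (ha : (s : Set α).Pairwise fun i i' => (d : ℝ) ≤ ∑ j, |a i j - a i' j|) :
    ∑ i ∈ s, ∏ j, (1 + a i j ^ 2)⁻¹ ≤ π ^ d := by
  have hint := integrable_prod_inv_one_add_sq (Fin d)
  calc ∑ i ∈ s, ∏ j, (1 + a i j ^ 2)⁻¹
      ≤ ∑ i ∈ s, ∫ x in {x : Fin d → ℝ | ∑ j, |x j - a i j| < (d : ℝ) / 2},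
          ∏ j, (1 + x j ^ 2)⁻¹ :=
        Finset.sum_le_sum fun i _ => prod_inv_one_add_sq_le_setIntegral hd (a i)
    _ = ∫ x in ⋃ i ∈ s, {x : Fin d → ℝ | ∑ j, |x j - a i j| < (d : ℝ) / 2},
          ∏ j, (1 + x j ^ 2)⁻¹ := by
        refine (integral_biUnion_finset s (fun i _ => measurableSet_sum_abs_sub_lt _ _) ?_
          fun _ _ => hint.integrableOn).symm
        intro i hi i' hi' hne
        refine Set.disjoint_left.mpr fun x hx hx' => ?_
        simp only [Set.mem_ofPred_eq] at hx hx'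
        have h : ∑ j, |a i j - a i' j| ≤ ∑ j, |x j - a i j| + ∑ j, |x j - a i' j| := by
          rw [← Finset.sum_add_distrib]
          refine Finset.sum_le_sum fun j _ => ?_
          rw [abs_sub_comm (x j) (a i j)]
          exact abs_sub_le _ _ _
        linarith [ha hi hi' hne]
    _ ≤ ∫ x : Fin d → ℝ, ∏ j, (1 + x j ^ 2)⁻¹ :=
        setIntegral_le_integral hint
          (.of_forall fun x => Finset.prod_nonneg fun _ _ => by positivity)
    _ = π ^ d := by rw [integral_prod_inv_one_add_sq, Fintype.card_fin]

theorem prod_abs_realEmbeddings_eq_abs_norm {F : Type*} [Field F] [NumberField F] {d : ℕ}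
    (hd : d = Module.finrank ℚ F) {σ : Fin d → (F →+* ℝ)} (hσ : Function.Injective σ)
    (x : F) :
    ∏ j, |σ j x| = |((Algebra.norm ℚ x : ℚ) : ℝ)| := by
  have hinj : Function.Injective
      fun j => RingHom.equivRatAlgHom F ℂ (Complex.ofRealHom.comp (σ j)) := by
    intro i j hij
    refine hσ (RingHom.ext fun x => ?_)
    have := RingHom.congr_fun ((RingHom.equivRatAlgHom F ℂ).injective hij) x
    simpa using this
  have hbij : Function.Bijective
      fun j => RingHom.equivRatAlgHom F ℂ (Complex.ofRealHom.comp (σ j)) := by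
    refine (Fintype.bijective_iff_injective_and_card _).mpr ⟨hinj, ?_⟩
    rw [Fintype.card_fin, hd, AlgHom.card]
  have h := Algebra.norm_eq_prod_embeddings ℚ ℂ x
  rw [← Function.Bijective.prod_comp hbij (fun φ : F →ₐ[ℚ] ℂ => φ x)] at h
  rw [← Finset.abs_prod]
  congr 1
  apply Complex.ofReal_injective
  push_cast
  simpa using h.symm

theorem one_le_prod_abs_realEmbeddings {F : Type*} [Field F] [NumberField F] {d : ℕ}
    (hd : d = Module.finrank ℚ F) {σ : Fin d → (F →+* ℝ)} (hσ : Function.Injective σ)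
    {x : 𝓞 F} (hx : x ≠ 0) : 1 ≤ ∏ j, |σ j (x : F)| := by
  rw [prod_abs_realEmbeddings_eq_abs_norm hd hσ, ← Algebra.coe_norm_int]
  exact_mod_cast Int.one_le_abs (Algebra.norm_ne_zero_iff.mpr hx)

theorem prod_abs_realEmbeddings_unit {F : Type*} [Field F] [NumberField F] {d : ℕ}
    (hd : d = Module.finrank ℚ F) {σ : Fin d → (F →+* ℝ)} (hσ : Function.Injective σ)
    (ε : (𝓞 F)ˣ) : ∏ j, |σ j ((ε : 𝓞 F) : F)| = 1 := by
  rw [prod_abs_realEmbeddings_eq_abs_norm hd hσ]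
  exact_mod_cast isUnit_iff_norm.mp ε.isUnit

/-- Distinct algebraic integers are at `ℓ¹`-distance at least `d` under the real embeddings. -/
theorem le_sum_abs_realEmbeddings_sub {F : Type*} [Field F] [NumberField F] {d : ℕ}
    (hd : d = Module.finrank ℚ F) {σ : Fin d → (F →+* ℝ)} (hσ : Function.Injective σ)
    {x y : 𝓞 F} (hxy : x ≠ y) :
    (d : ℝ) ≤ ∑ j, |σ j (x : F) - σ j (y : F)| := by
  have h := one_le_prod_abs_realEmbeddings hd hσ (sub_ne_zero.mpr hxy)
  simp only [map_sub] at h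
  have h' : (1 : ℝ) ≤ exp (∑ j, (|σ j (x : F) - σ j (y : F)| - 1)) := by
    rw [exp_sum]
    refine h.trans (Finset.prod_le_prod (fun _ _ => abs_nonneg _) fun j _ => ?_)
    linarith [add_one_le_exp (|σ j (x : F) - σ j (y : F)| - 1)]
  rw [one_le_exp_iff] at h'
  simpa using h'

theorem sum_units_prod_inv_one_add_sq_le {F : Type*} [Field F] [NumberField F] {d : ℕ}
    (hd : d = Module.finrank ℚ F) {σ : Fin d → (F →+* ℝ)} (hσ : Function.Injective σ)
    (s : Finset (𝓞 F)ˣ) :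
    ∑ ε ∈ s, ∏ j, (1 + σ j ((ε : 𝓞 F) : F) ^ 2)⁻¹ ≤ π ^ d := by
  have hpos : 0 < d := hd ▸ Module.finrank_pos
  obtain h1 | h2 : d = 1 ∨ 2 ≤ d := by omega
  · subst h1
    have habs (ε : (𝓞 F)ˣ) : |σ 0 ((ε : 𝓞 F) : F)| = 1 := by
      simpa using prod_abs_realEmbeddings_unit hd hσ ε
    have hcard : s.card ≤ 2 := by
      refine (Finset.card_le_card_of_injOn (s := s) (t := ({1, -1} : Finset ℝ))
        (fun ε : (𝓞 F)ˣ => σ 0 ((ε : 𝓞 F) : F)) (fun ε _ => ?_) fun ε _ η _ h => ?_).trans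
          Finset.card_le_two
      · simpa using (abs_eq zero_le_one).mp (habs ε)
      · exact Units.ext (RingOfIntegers.ext ((σ 0).injective h))
    have hsum : ∑ ε ∈ s, ∏ j, (1 + σ j ((ε : 𝓞 F) : F) ^ 2)⁻¹ =
        (s.card : ℝ) * (1 / 2) := by
      rw [← nsmul_eq_mul]
      refine Finset.sum_eq_card_nsmul fun ε _ => ?_
      rw [Fin.prod_univ_one, ← sq_abs, habs]
      norm_num
    have hcard' : (s.card : ℝ) ≤ 2 := by exact_mod_cast hcard
    rw [hsum, pow_one]
    linarith [pi_gt_three]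
  · refine sum_prod_inv_one_add_sq_le h2 s (fun ε j => σ j ((ε : 𝓞 F) : F)) fun ε _ η _ hne => ?_
    exact le_sum_abs_realEmbeddings_sub hd hσ fun h => hne (Units.ext h)

theorem abs_pow_mul_zpow_le (x : ℝ) {k : ℕ} (hk : 1 ≤ k) :
    |x| ^ (2 * k - 1) * ((1 + x ^ 2) / 2) ^ (1 - 2 * (k : ℤ)) ≤ |x| * (2 * (1 + x ^ 2)⁻¹) := by
  have hexp : (1 - 2 * (k : ℤ)) = -((2 * k - 1 : ℕ) : ℤ) := by omega
  have hle : |x| * (2 * (1 + x ^ 2)⁻¹) ≤ 1 := by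
    rw [← mul_assoc, ← div_eq_mul_inv, div_le_one (by positivity), ← sq_abs]
    nlinarith [sq_nonneg (|x| - 1)]
  rw [hexp, zpow_neg, zpow_natCast, ← inv_pow, ← mul_pow, inv_div, div_eq_mul_inv]
  exact pow_le_of_le_one (by positivity) hle (by omega)

/-- Let `F` be a totally real number field of degree `d`, with distinct real embeddings
`σ₁, …, σ_d`, `k_j ≥ 1` integers and `y_j > 0` reals. Then the sum over units `ε ∈ (𝓞 F)ˣ` of
`∏_j |σ_j(ε)|^{2k_j−1} · y_j · ((1 + σ_j(ε)²)/2)^{1−2k_j}` converges and is at most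
`∏_j 2π y_j`. -/
theorem tsum_units_prod_le (F : Type) [Field F] [NumberField F]
    (htr : ∀ v : InfinitePlace F, v.IsReal)
    (d : ℕ) (hd : d = Module.finrank ℚ F)
    (σ : Fin d → (F →+* ℝ)) (hσ : Function.Injective σ)
    (k : Fin d → ℕ) (hk : ∀ j, 1 ≤ k j) (y : Fin d → ℝ) (hy : ∀ j, 0 < y j) :
    Summable (fun ε : (𝓞 F)ˣ =>
      ∏ j : Fin d, |σ j ((ε : 𝓞 F) : F)| ^ (2 * k j - 1) * y j *
        ((1 + (σ j ((ε : 𝓞 F) : F)) ^ 2) / 2) ^ (1 - 2 * (k j : ℤ))) ∧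
    ∑' ε : (𝓞 F)ˣ,
        ∏ j : Fin d, |σ j ((ε : 𝓞 F) : F)| ^ (2 * k j - 1) * y j *
          ((1 + (σ j ((ε : 𝓞 F) : F)) ^ 2) / 2) ^ (1 - 2 * (k j : ℤ)) ≤
      ∏ j : Fin d, 2 * Real.pi * y j := by
  set f : (𝓞 F)ˣ → ℝ := fun ε => ∏ j : Fin d, |σ j ((ε : 𝓞 F) : F)| ^ (2 * k j - 1) * y j *
    ((1 + (σ j ((ε : 𝓞 F) : F)) ^ 2) / 2) ^ (1 - 2 * (k j : ℤ)) with hf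
  have hnonneg : 0 ≤ f := fun ε => Finset.prod_nonneg fun j _ => by
    have := hy j
    positivity
  have hterm (ε : (𝓞 F)ˣ) :
      f ε ≤ (∏ j, 2 * y j) * ∏ j, (1 + σ j ((ε : 𝓞 F) : F) ^ 2)⁻¹ := by
    calc f ε ≤ ∏ j, |σ j ((ε : 𝓞 F) : F)| * (2 * y j * (1 + σ j ((ε : 𝓞 F) : F) ^ 2)⁻¹) := by
          refine Finset.prod_le_prod (fun j _ => ?_) fun j _ => ?_
          · have := hy j
            positivity
          · have := mul_le_mul_of_nonneg_right
              (abs_pow_mul_zpow_le (σ j ((ε : 𝓞 F) : F)) (hk j)) (hy j).le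
            linarith
      _ = _ := by
          rw [Finset.prod_mul_distrib, prod_abs_realEmbeddings_unit hd hσ, one_mul,
            Finset.prod_mul_distrib]
  have hbound (s : Finset (𝓞 F)ˣ) : ∑ ε ∈ s, f ε ≤ ∏ j : Fin d, 2 * Real.pi * y j := by
    calc ∑ ε ∈ s, f ε
        ≤ (∏ j, 2 * y j) * ∑ ε ∈ s, ∏ j, (1 + σ j ((ε : 𝓞 F) : F) ^ 2)⁻¹ := by
          rw [Finset.mul_sum]
          exact Finset.sum_le_sum fun ε _ => hterm ε
      _ ≤ (∏ j, 2 * y j) * π ^ d := by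
          refine mul_le_mul_of_nonneg_left (sum_units_prod_inv_one_add_sq_le hd hσ s) ?_
          exact Finset.prod_nonneg fun j _ => by linarith [hy j]
      _ = ∏ j : Fin d, 2 * Real.pi * y j := by
          simp only [Finset.prod_mul_distrib, Finset.prod_const, Finset.card_univ,
            Fintype.card_fin]
          ring
  exact ⟨summable_of_sum_le hnonneg hbound, Real.tsum_le_of_sum_le hnonneg hbound⟩
end
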